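/- Let p = rur. Then for all integers m ≥ n ≥ 1, in ℚ: s_p(n, m) = (m − n + 1) · Σ_{i=0}^{n−1} (−1)^i · (1/(m − i + 1)) · C(n − 1, i) · C(m + n − 2i, n − i). -/

import Mathlib

/-- A step of a lattice path: `u` (up) or `r` (right). -/
inductive Step : Type
  | u : Step
  | r : Step
deriving DecidableEq

/-- A word over the alphabet `{u, r}`. -/
abbrev Word := List Step

/-- The number of letters `r` in a word. -/
def countR (w : Word) : ℕ := w.count Step.r

/-- The number of letters `u` in a word. -/
def countU (w : Word) : ℕ := w.count Step.u

/-- `dval q` = (number of `r`'s in `q`) - (number of `u`'s in `q`). -/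
def dval (w : Word) : ℤ := (countR w : ℤ) - (countU w : ℤ)

/-- A pattern is depth-zero if every suffix `q` of it satisfies `dval q ≥ 0`. -/
def DepthZero (p : Word) : Prop := ∀ q : Word, q <:+ p → 0 ≤ dval q

/-- `o` is a bifix of `p`: a nonempty proper prefix of `p` that is also a (proper) suffix. -/
def IsBifix (o p : Word) : Prop := o ≠ [] ∧ o ≠ p ∧ o <+: p ∧ o <:+ p

/-- A pattern is bifix-free if it has no bifix. -/
def BifixFree (p : Word) : Prop := ∀ o : Word, ¬ IsBifix o p

/-- `w` is a ballot path to the lattice point `(n, m)`: it has exactly `n` letters `r`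
and `m` letters `u`, and every prefix has at least as many `u`'s as `r`'s. -/
def IsBallot (w : Word) (n m : ℤ) : Prop :=
  (countR w : ℤ) = n ∧ (countU w : ℤ) = m ∧
    ∀ t : Word, t <+: w → countR t ≤ countU t

/-- `w` avoids the pattern `p`: `p` does not occur in `w` as a contiguous substring. -/
def Avoids (p w : Word) : Prop := ¬ p <:+: w

/-- `s p n m` is the number of ballot paths to `(n, m)` avoiding `p`
(`0` if `n < 0`, `m < 0`, or `m < n`, since then no such path exists). -/
noncomputable def s (p : Word) (n m : ℤ) : ℕ :=
  Set.ncard {w : Word | IsBallot w n m ∧ Avoids p w}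

/-- The pattern `rur`. -/
def rur : Word := [Step.r, Step.u, Step.r]

/-- The words counted by `s rur n m`, with natural number coordinates. -/
def ballotSet (n m : ℕ) : Set Word :=
  {w | countR w = n ∧ countU w = m ∧ (∀ t : Word, t <+: w → countR t ≤ countU t) ∧
    Avoids rur w}

/-- The words that become members of `ballotSet n m` when a final `r` is added. -/
def ballotSetR (n m : ℕ) : Set Word := {w | w ++ [Step.r] ∈ ballotSet n m}

theorem s_rur_eq_ncard (n m : ℕ) : s rur n m = (ballotSet n m).ncard := by
  unfold s ballotSet IsBallot
  simp only [Nat.cast_inj, and_assoc]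

@[simp] theorem countR_append (v w : Word) : countR (v ++ w) = countR v + countR w :=
  List.count_append

@[simp] theorem countU_append (v w : Word) : countU (v ++ w) = countU v + countU w :=
  List.count_append

@[simp] theorem countR_singleton_r : countR [Step.r] = 1 := rfl
@[simp] theorem countR_singleton_u : countR [Step.u] = 0 := rfl
@[simp] theorem countU_singleton_r : countU [Step.r] = 0 := rfl
@[simp] theorem countU_singleton_u : countU [Step.u] = 1 := rfl

theorem countR_add_countU (w : Word) : countR w + countU w = w.length := by
  induction w with
  | nil => rfl
  | cons a w ih => cases a <;> simp_all [countR, countU] <;> omega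

theorem rur_suffix_append_r (w : Word) :
    rur <:+ w ++ [Step.r] ↔ [Step.r, Step.u] <:+ w := by
  change [Step.r, Step.u] ++ [Step.r] <:+ _ ↔ _
  constructor
  · rintro ⟨t, ht⟩
    rw [← List.append_assoc] at ht
    exact ⟨t, List.append_cancel_right ht⟩
  · rintro ⟨t, rfl⟩
    exact ⟨t, by simp⟩

theorem not_rur_suffix_append_u (w : Word) : ¬ rur <:+ w ++ [Step.u] := by
  rintro ⟨t, ht⟩
  have h := congrArg List.getLast? ht
  simp [rur] at h

theorem append_u_mem_ballotSet (w : Word) (n m : ℕ) :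
    w ++ [Step.u] ∈ ballotSet n (m + 1) ↔ w ∈ ballotSet n m := by
  simp only [ballotSet, Set.mem_ofPred_eq, Avoids, List.infix_concat_iff,
    List.prefix_concat_iff, not_rur_suffix_append_u, false_or, countR_append, countU_append,
    countR_singleton_u, countU_singleton_u, add_zero, add_left_inj]
  refine and_congr_right fun _ => and_congr_right fun _ => and_congr_left fun _ => ?_
  constructor
  · exact fun h t ht => h t (Or.inr ht)
  · rintro h t (rfl | ht)
    · have := h w List.prefix_rfl
      simp only [countR_append, countU_append, countR_singleton_u, countU_singleton_u]
      omega
    · exact h t ht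

theorem append_r_mem_ballotSet (w : Word) (n m : ℕ) :
    w ++ [Step.r] ∈ ballotSet (n + 1) m ↔
      w ∈ ballotSet n m ∧ n + 1 ≤ m ∧ ¬ [Step.r, Step.u] <:+ w := by
  simp only [ballotSet, Set.mem_ofPred_eq, Avoids, List.infix_concat_iff,
    List.prefix_concat_iff, rur_suffix_append_r, countR_append, countU_append,
    countR_singleton_r, countU_singleton_r, add_zero, add_left_inj, not_or]
  constructor
  · rintro ⟨hn, hm, h, h1, h2⟩
    have h3 := h _ (Or.inl rfl)
    simp only [countR_append, countU_append, countR_singleton_r, countU_singleton_r] at h3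
    exact ⟨⟨hn, hm, fun t ht => h t (Or.inr ht), h2⟩, by omega, h1⟩
  · rintro ⟨⟨hn, hm, h, h2⟩, h3, h1⟩
    refine ⟨hn, hm, ?_, h1, h2⟩
    rintro t (rfl | ht)
    · simp only [countR_append, countU_append, countR_singleton_r, countU_singleton_r]
      omega
    · exact h t ht

theorem ballotSet_finite (n m : ℕ) : (ballotSet n m).Finite := by
  have : Finite Step :=
    Finite.of_injective (fun a : Step => decide (a = Step.u)) (by
      intro a b; cases a <;> cases b <;> simp)
  refine (List.finite_length_eq Step (n + m)).subset ?_
  rintro w ⟨h1, h2, -⟩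
  simp [← countR_add_countU, h1, h2]

theorem ballotSet_eq_empty {n m : ℕ} (h : m < n) : ballotSet n m = ∅ := by
  ext w
  simp only [Set.mem_empty_iff_false, iff_false]
  rintro ⟨h1, h2, h3, -⟩
  have := h3 w List.prefix_rfl
  omega

theorem ballotSetR_zero (m : ℕ) : ballotSetR 0 m = ∅ := by
  ext w
  simp only [Set.mem_empty_iff_false, iff_false]
  rintro ⟨h1, -⟩
  simp at h1

theorem ncard_ballotSet_zero_zero : (ballotSet 0 0).ncard = 1 := by
  rw [Set.ncard_eq_one]
  refine ⟨[], Set.ext fun w => ?_⟩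
  rw [Set.mem_singleton_iff]
  constructor
  · rintro ⟨h1, h2, -⟩
    have := countR_add_countU w
    exact List.eq_nil_of_length_eq_zero (by omega)
  · rintro rfl
    refine ⟨rfl, rfl, fun t ht => ?_, ?_⟩
    · simp [List.prefix_nil.mp ht, countR, countU]
    · simp [Avoids, rur]

theorem ncard_ballotSet_succ (n m : ℕ) :
    (ballotSet n (m + 1)).ncard = (ballotSet n m).ncard + (ballotSetR n (m + 1)).ncard := by
  have hfin := ballotSet_finite n (m + 1)
  have h : ballotSet n (m + 1) =
      (· ++ [Step.u]) '' ballotSet n m ∪ (· ++ [Step.r]) '' ballotSetR n (m + 1) := by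
    ext w
    simp only [Set.mem_union, Set.mem_image]
    constructor
    · intro hw
      rcases List.eq_nil_or_concat' w with rfl | ⟨v, a, rfl⟩
      · simp [ballotSet, countU] at hw
      · cases a
        · exact Or.inl ⟨v, (append_u_mem_ballotSet v n m).mp hw, rfl⟩
        · exact Or.inr ⟨v, hw, rfl⟩
    · rintro (⟨v, hv, rfl⟩ | ⟨v, hv, rfl⟩)
      · exact (append_u_mem_ballotSet v n m).mpr hv
      · exact hv
  have hd : Disjoint ((· ++ [Step.u]) '' ballotSet n m)
      ((· ++ [Step.r]) '' ballotSetR n (m + 1)) := by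
    rw [Set.disjoint_left]
    rintro _ ⟨v, -, rfl⟩ ⟨v', -, h⟩
    have := congrArg List.getLast? h
    simp at this
  rw [h] at hfin
  rw [h, Set.ncard_union_eq hd (hfin.subset Set.subset_union_left)
    (hfin.subset Set.subset_union_right),
    Set.ncard_image_of_injective _ (List.append_left_injective _),
    Set.ncard_image_of_injective _ (List.append_left_injective _)]

theorem ncard_ballotSet_eq_add_ballotSetR {n m : ℕ} (h : n ≤ m) :
    (ballotSet n (m + 1)).ncard =
      (ballotSetR (n + 1) (m + 1)).ncard + (ballotSetR n m).ncard := by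
  have hfin := ballotSet_finite n (m + 1)
  have hu : ballotSet n (m + 1) =
      ballotSetR (n + 1) (m + 1) ∪ (· ++ [Step.r, Step.u]) '' ballotSetR n m := by
    ext w
    simp only [Set.mem_union, Set.mem_image, ballotSetR, Set.mem_ofPred_eq,
      append_r_mem_ballotSet]
    constructor
    · intro hw
      by_cases hs : [Step.r, Step.u] <:+ w
      · obtain ⟨v, rfl⟩ := hs
        refine Or.inr ⟨v, (append_u_mem_ballotSet _ n m).mp ?_, rfl⟩
        simpa using hw
      · exact Or.inl ⟨hw, by omega, hs⟩
    · rintro (⟨hw, -⟩ | ⟨v, hv, rfl⟩)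
      · exact hw
      · simpa using (append_u_mem_ballotSet _ n m).mpr hv
  have hd : Disjoint (ballotSetR (n + 1) (m + 1))
      ((· ++ [Step.r, Step.u]) '' ballotSetR n m) := by
    rw [Set.disjoint_left]
    rintro _ hw ⟨v, -, rfl⟩
    exact ((append_r_mem_ballotSet _ _ _).mp hw).2.2 ⟨v, rfl⟩
  rw [hu] at hfin
  rw [hu, Set.ncard_union_eq hd (hfin.subset Set.subset_union_left)
    (hfin.subset Set.subset_union_right),
    Set.ncard_image_of_injective _ (List.append_left_injective _)]

theorem ncard_ballotSet_zero (m : ℕ) : (ballotSet 0 m).ncard = 1 := by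
  induction m with
  | zero => exact ncard_ballotSet_zero_zero
  | succ m ih => rw [ncard_ballotSet_succ, ih, ballotSetR_zero, Set.ncard_empty]

theorem ncard_ballotSet_one (m : ℕ) : (ballotSet 1 m).ncard = m := by
  induction m with
  | zero => rw [ballotSet_eq_empty one_pos, Set.ncard_empty]
  | succ m ih =>
    have h := ncard_ballotSet_eq_add_ballotSetR (Nat.zero_le m)
    rw [ballotSetR_zero, Set.ncard_empty, ncard_ballotSet_zero, zero_add] at h
    have h' := ncard_ballotSet_succ 1 m
    omega

theorem ncard_ballotSet_rec {n m : ℕ} (h : n ≤ m + 1) :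
    (ballotSet (n + 1) (m + 2)).ncard + (ballotSet n (m + 1)).ncard =
      (ballotSet (n + 1) (m + 1)).ncard + (ballotSet n (m + 2)).ncard +
        (ballotSet n m).ncard := by
  have h1 := ncard_ballotSet_succ (n + 1) (m + 1)
  have h2 := ncard_ballotSet_eq_add_ballotSetR h
  have h3 := ncard_ballotSet_succ n m
  simp only [add_assoc, Nat.reduceAdd] at *
  omega

/-- The number `e / (n + e) * C(2n + e - 1, n)` of ballot paths to `(n, n + e - 1)`. -/
def ballotNumber (n e : ℕ) : ℚ :=
  e * (1 / ((n : ℚ) + e)) * (Nat.choose (2 * n + e - 1) n : ℚ)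

theorem ballotNumber_zero_right (n : ℕ) : ballotNumber n 0 = 0 := by
  simp [ballotNumber]

theorem ballotNumber_one_left (e : ℕ) : ballotNumber 1 e = e := by
  have h : (1 + e : ℚ) ≠ 0 := by positivity
  have h2 : 2 * 1 + e - 1 = 1 + e := by omega
  simp [ballotNumber, h2, h]

theorem ballotNumber_succ_succ (n e : ℕ) :
    ballotNumber (n + 1) (e + 1) = ballotNumber (n + 1) e + ballotNumber n (e + 2) := by
  have e1 : 2 * (n + 1) + (e + 1) - 1 = 2 * n + e + 1 + 1 := by omega
  have e2 : 2 * (n + 1) + e - 1 = 2 * n + e + 1 := by omega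
  have e3 : 2 * n + (e + 2) - 1 = 2 * n + e + 1 := by omega
  have key := Nat.choose_succ_right_eq (2 * n + e + 1) n
  rw [show 2 * n + e + 1 - n = n + e + 1 by omega] at key
  have key' : (Nat.choose (2 * n + e + 1) (n + 1) : ℚ) * (n + 1) =
      Nat.choose (2 * n + e + 1) n * (n + e + 1) := by exact_mod_cast key
  unfold ballotNumber
  rw [e1, e2, e3, Nat.choose_succ_succ']
  push_cast
  have h1 : (n + 1 + e : ℚ) ≠ 0 := by positivity
  have h2 : (n + 1 + (e + 1) : ℚ) ≠ 0 := by positivity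
  rw [show (n + (e + 2) : ℚ) = n + 1 + (e + 1) by ring]
  field_simp
  linear_combination key'

/-- The `k`-th backward difference of `ballotNumber n e` in `n`. -/
def ballotDiff (k n e : ℕ) : ℚ :=
  ∑ i ∈ Finset.range (k + 1), (-1 : ℚ) ^ i * (Nat.choose k i : ℚ) * ballotNumber (n - i) e

theorem ballotDiff_zero_right (k n : ℕ) : ballotDiff k n 0 = 0 := by
  simp [ballotDiff, ballotNumber_zero_right]

theorem ballotDiff_succ_succ {k n : ℕ} (h : k ≤ n) (e : ℕ) :
    ballotDiff k (n + 1) (e + 1) = ballotDiff k (n + 1) e + ballotDiff k n (e + 2) := by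
  unfold ballotDiff
  rw [← Finset.sum_add_distrib]
  refine Finset.sum_congr rfl fun i hi => ?_
  rw [Finset.mem_range] at hi
  rw [show n + 1 - i = n - i + 1 by omega, ballotNumber_succ_succ]
  ring

theorem ballotDiff_succ_left (k n e : ℕ) :
    ballotDiff (k + 1) (n + 1) e = ballotDiff k (n + 1) e - ballotDiff k n e := by
  have h : ballotDiff k (n + 1) e = ∑ i ∈ Finset.range (k + 2),
      (-1 : ℚ) ^ i * (Nat.choose k i : ℚ) * ballotNumber (n + 1 - i) e := by
    rw [Finset.sum_range_succ _ (k + 1)]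
    simp [ballotDiff]
  rw [h, ballotDiff, ballotDiff, Finset.sum_range_succ', Finset.sum_range_succ' _ (k + 1),
    add_sub_right_comm, ← Finset.sum_sub_distrib]
  congr 1
  · refine Finset.sum_congr rfl fun i _ => ?_
    rw [Nat.choose_succ_succ', Nat.add_sub_add_right]
    push_cast
    ring
  · simp

theorem ncard_ballotSet_eq_ballotDiff (n e : ℕ) :
    ((ballotSet (n + 1) (n + e)).ncard : ℚ) = ballotDiff n (n + 1) e := by
  induction n generalizing e with
  | zero => simp [ncard_ballotSet_one, ballotDiff, ballotNumber_one_left]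
  | succ n ihn =>
    induction e with
    | zero =>
      rw [ballotSet_eq_empty (by omega), Set.ncard_empty, ballotDiff_zero_right, Nat.cast_zero]
    | succ e ihe =>
      have h : ((ballotSet (n + 1 + 1) (n + e + 2)).ncard : ℚ) +
          (ballotSet (n + 1) (n + e + 1)).ncard =
          (ballotSet (n + 1 + 1) (n + e + 1)).ncard + (ballotSet (n + 1) (n + e + 2)).ncard +
          (ballotSet (n + 1) (n + e)).ncard := by
        exact_mod_cast ncard_ballotSet_rec (n := n + 1) (m := n + e) (by omega)
      have h1 := ihn e
      have h2 := ihn (e + 1)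
      have h3 := ihn (e + 2)
      rw [show n + 1 + e = n + e + 1 by omega] at ihe
      rw [show n + (e + 1) = n + e + 1 by omega] at h2
      rw [show n + (e + 2) = n + e + 2 by omega] at h3
      rw [show n + 1 + (e + 1) = n + e + 2 by omega]
      have t1 := ballotDiff_succ_left n (n + 1) e
      have t2 := ballotDiff_succ_left n (n + 1) (e + 1)
      have t3 := ballotDiff_succ_succ (Nat.le_succ n) e
      simp only [Nat.succ_eq_add_one] at t3
      linarith

/-- Explicit formula for ballot paths avoiding `rur`: for `m ≥ n ≥ 1`,
`s rur n m = (m-n+1) ∑_{i=0}^{n-1} (-1)^i/(m-i+1) C(n-1, i) C(m+n-2i, n-i)`. -/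
theorem ballot_avoiding_rur_formula (n m : ℕ) (hn : 1 ≤ n) (hnm : n ≤ m) :
    (s rur n m : ℚ) = ((m : ℚ) - n + 1) *
      ∑ i ∈ Finset.range n,
        (-1 : ℚ) ^ i * (1 / ((m : ℚ) - i + 1)) *
          (Nat.choose (n - 1) i : ℚ) * (Nat.choose (m + n - 2 * i) (n - i) : ℚ) := by
  obtain ⟨k, rfl⟩ : ∃ k, n = k + 1 := ⟨n - 1, by omega⟩
  obtain ⟨e, rfl⟩ : ∃ e, m = k + e := ⟨m - k, by omega⟩
  rw [s_rur_eq_ncard, ncard_ballotSet_eq_ballotDiff, ballotDiff, Finset.mul_sum]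
  refine Finset.sum_congr rfl fun i hi => ?_
  have hik : i ≤ k + 1 := (Finset.mem_range.mp hi).le
  rw [ballotNumber, show 2 * (k + 1 - i) + e - 1 = k + e + (k + 1) - 2 * i by
    have := Finset.mem_range.mp hi
    omega, Nat.add_sub_cancel]
  push_cast [Nat.cast_sub hik]
  rw [show (k + 1 - i + e : ℚ) = k + e - i + 1 by ring]
  ring
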